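/- arXiv:2504.17612 — 4 statements merged into one kernel-verified Lean document; each statement's English description precedes it below -/
import Mathlib

section
/- There is no linear isometry D from ℂ² to ℂ²⊗ℂ² together with functions θ₁, θ₂ : ℝ → ℝ such that D|+_θ⟩ = |+_{θ₁(θ)}⟩ ⊗ |+_{θ₂(θ)}⟩ for all θ ∈ ℝ while both factor-state maps θ ↦ |+_{θ₁(θ)}⟩ and θ ↦ |+_{θ₂(θ)}⟩ are non-constant. Equivalently: for every linear isometry D : ℂ² → ℂ²⊗ℂ² and all functions θ₁, θ₂ : ℝ → ℝ satisfying D|+_θ⟩ = |+_{θ₁(θ)}⟩ ⊗ |+_{θ₂(θ)}⟩ for every θ ∈ ℝ, at least one of the two maps θ ↦ |+_{θ₁(θ)}⟩, θ ↦ |+_{θ₂(θ)}⟩ is a constant function of θ. -/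
/-- The planar state `|+_θ⟩ = (1/√2)(e₀ + e^{iθ} e₁)` in `Fin 2 → ℂ`. -/
noncomputable def plus (θ : ℝ) : Fin 2 → ℂ :=
  fun i => (1 / Real.sqrt 2 : ℂ) * Complex.exp (θ * Complex.I) ^ (i : ℕ)

/-- The tensor product of two one-qubit vectors, `(v ⊗ w)(i,j) = v i * w j`. -/
def tens (v w : Fin 2 → ℂ) : Fin 2 × Fin 2 → ℂ :=
  fun p => v p.1 * w p.2

/-- A linear map acts on a planar state through its values on the standard basis. -/
theorem map_plus_apply (D : (Fin 2 → ℂ) →ₗ[ℂ] (Fin 2 × Fin 2 → ℂ)) (θ : ℝ)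
    (p : Fin 2 × Fin 2) :
    D (plus θ) p = (1 / Real.sqrt 2 : ℂ) *
      (D (Pi.single 0 1) p + Complex.exp (θ * Complex.I) * D (Pi.single 1 1) p) := by
  have h : plus θ = (1 / Real.sqrt 2 : ℂ) • (Pi.single 0 1 : Fin 2 → ℂ) +
      ((1 / Real.sqrt 2 : ℂ) * Complex.exp (θ * Complex.I)) • (Pi.single 1 1 : Fin 2 → ℂ) := by
    funext i
    fin_cases i <;> simp [plus]
  rw [h, map_add, map_smul, map_smul]
  simp only [Pi.add_apply, Pi.smul_apply, smul_eq_mul]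
  ring

/-- If a product of two affine functions agrees with an affine function on the unit circle,
then one of the two factors has zero slope. -/
theorem slope_eq_zero_or_of_affine_mul_affine {a b c d e f : ℂ}
    (h : ∀ θ : ℝ, (a + Complex.exp (θ * Complex.I) * b) * (c + Complex.exp (θ * Complex.I) * d) =
      e + Complex.exp (θ * Complex.I) * f) : b = 0 ∨ d = 0 := by
  have h₁ := h 0
  have h₂ := h Real.pi
  have h₃ := h (Real.pi / 2)
  have h₄ := h (-(Real.pi / 2))
  have e₃ : Complex.exp (((Real.pi / 2 : ℝ) : ℂ) * Complex.I) = Complex.I := by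
    push_cast
    exact Complex.exp_pi_div_two_mul_I
  have e₄ : Complex.exp (((-(Real.pi / 2) : ℝ) : ℂ) * Complex.I) = -Complex.I := by
    rw [Complex.ofReal_neg, Complex.ofReal_div, Complex.ofReal_ofNat, ← neg_div]
    exact Complex.exp_neg_pi_div_two_mul_I
  rw [Complex.ofReal_zero, zero_mul, Complex.exp_zero] at h₁
  rw [Complex.exp_pi_mul_I] at h₂
  rw [e₃] at h₃
  rw [e₄] at h₄
  rw [← mul_eq_zero]
  linear_combination (h₁ + h₂ - h₃ - h₄) / 4 + b * d / 2 * Complex.I_sq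

/-- The planar state is determined by its relative phase. -/
theorem plus_congr {θ θ' : ℝ}
    (h : Complex.exp (θ * Complex.I) = Complex.exp (θ' * Complex.I)) : plus θ = plus θ' := by
  unfold plus
  rw [h]

/-- No linear isometry splits the planar-state family into a product of two
non-constant planar-state families: one of the factor maps must be constant. -/
theorem no_planar_state_splitting_isometry
    (D : (Fin 2 → ℂ) →ₗ[ℂ] (Fin 2 × Fin 2 → ℂ))
    (hIso : ∀ v w : Fin 2 → ℂ,
      ∑ p : Fin 2 × Fin 2, star (D v p) * D w p = ∑ i : Fin 2, star (v i) * w i)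
    (θ₁ θ₂ : ℝ → ℝ)
    (hD : ∀ θ : ℝ, D (plus θ) = tens (plus (θ₁ θ)) (plus (θ₂ θ))) :
    (∀ θ θ' : ℝ, plus (θ₁ θ) = plus (θ₁ θ')) ∨
    (∀ θ θ' : ℝ, plus (θ₂ θ) = plus (θ₂ θ')) := by
  have hs : (1 / Real.sqrt 2 : ℂ) ≠ 0 := by simp
  have key (θ : ℝ) (i j : Fin 2) :
      D (Pi.single 0 1) (i, j) + Complex.exp (θ * Complex.I) * D (Pi.single 1 1) (i, j) =
        (1 / Real.sqrt 2 : ℂ) * (Complex.exp (θ₁ θ * Complex.I) ^ (i : ℕ) *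
          Complex.exp (θ₂ θ * Complex.I) ^ (j : ℕ)) := by
    have h := congrFun (hD θ) (i, j)
    rw [map_plus_apply] at h
    simp only [tens, plus] at h
    apply mul_left_cancel₀ hs
    rw [h]
    ring
  have h₁ (θ : ℝ) := key θ 1 0
  have h₂ (θ : ℝ) := key θ 0 1
  have h₃ (θ : ℝ) := key θ 1 1
  simp only [Fin.val_zero, Fin.val_one, pow_zero, pow_one, one_mul, mul_one] at h₁ h₂ h₃
  have hslope : D (Pi.single 1 1) (1, 0) = 0 ∨ D (Pi.single 1 1) (0, 1) = 0 := by
    refine slope_eq_zero_or_of_affine_mul_affine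
      (a := D (Pi.single 0 1) (1, 0)) (c := D (Pi.single 0 1) (0, 1))
      (e := (1 / Real.sqrt 2 : ℂ) * D (Pi.single 0 1) (1, 1))
      (f := (1 / Real.sqrt 2 : ℂ) * D (Pi.single 1 1) (1, 1)) fun θ => ?_
    rw [h₁, h₂]
    linear_combination -(1 / Real.sqrt 2 : ℂ) * h₃ θ
  refine hslope.imp (fun h θ θ' => ?_) (fun h θ θ' => ?_)
  · refine plus_congr (mul_left_cancel₀ hs ?_)
    rw [← h₁, ← h₁, h, mul_zero, mul_zero]
  · refine plus_congr (mul_left_cancel₀ hs ?_)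
    rw [← h₂, ← h₂, h, mul_zero, mul_zero]
end

section
/- Let D : ℂ² → ℂ²⊗ℂ² be a linear isometry and γ, δ ∈ ℝ be such that D|+⟩ = |+⟩ ⊗ |+⟩ and D|−⟩ = |+_γ⟩ ⊗ |+_δ⟩, where |+⟩ = |+_0⟩ and |−⟩ = |+_π⟩. Then e^{iγ} = −1 or e^{iδ} = −1 (i.e. γ ≡ π or δ ≡ π modulo 2π). -/
theorem sum_star_tens_mul_tens (a b c d : Fin 2 → ℂ) :
    ∑ p : Fin 2 × Fin 2, star (tens a b p) * tens c d p =
      (∑ i, star (a i) * c i) * ∑ j, star (b j) * d j := by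
  rw [Fintype.sum_prod_type, Finset.sum_mul_sum]
  simp only [tens, star_mul']
  exact Finset.sum_congr rfl fun _ _ => Finset.sum_congr rfl fun _ _ => by ring

theorem sum_star_plus_zero_mul_plus (θ : ℝ) :
    ∑ i, star (plus 0 i) * plus θ i = (1 + Complex.exp (θ * Complex.I)) / 2 := by
  have h : (1 / Real.sqrt 2 : ℂ) * (1 / Real.sqrt 2 : ℂ) = 1 / 2 := by
    rw [div_mul_div_comm, ← Complex.ofReal_mul, Real.mul_self_sqrt zero_le_two]
    norm_num
  have hs : star (1 / Real.sqrt 2 : ℂ) = 1 / Real.sqrt 2 := by simp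
  simp only [plus, Fin.sum_univ_two, Complex.ofReal_zero, zero_mul, Complex.exp_zero, one_pow,
    mul_one, hs, ← mul_assoc, h, Fin.val_zero, Fin.val_one, pow_zero, pow_one]
  ring

/-- If a linear isometry `D` sends `|+⟩` to `|+⟩⊗|+⟩` and `|−⟩` to `|+_γ⟩⊗|+_δ⟩`,
then `e^{iγ} = −1` or `e^{iδ} = −1`. -/
theorem isometry_forces_pi
    (D : (Fin 2 → ℂ) →ₗ[ℂ] (Fin 2 × Fin 2 → ℂ))
    (hIso : ∀ v w : Fin 2 → ℂ,
      ∑ p : Fin 2 × Fin 2, star (D v p) * D w p = ∑ i : Fin 2, star (v i) * w i)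
    (γ δ : ℝ)
    (hPlus : D (plus 0) = tens (plus 0) (plus 0))
    (hMinus : D (plus Real.pi) = tens (plus γ) (plus δ)) :
    Complex.exp (γ * Complex.I) = -1 ∨ Complex.exp (δ * Complex.I) = -1 := by
  have h := hIso (plus 0) (plus Real.pi)
  rw [hPlus, hMinus, sum_star_tens_mul_tens] at h
  simp only [sum_star_plus_zero_mul_plus, Complex.exp_pi_mul_I, add_neg_cancel, zero_div,
    mul_eq_zero, div_eq_zero_iff, two_ne_zero, or_false] at h
  exact h.imp eq_neg_of_add_eq_zero_right eq_neg_of_add_eq_zero_right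
end

section
/- There is no linear map D : ℂ² → ℂ²⊗ℂ² whose action on the planar-state family reaches every product of planar states: i.e., there is no ℂ-linear D such that for all θ₁, θ₂ ∈ ℝ there exists θ ∈ ℝ with D|+_θ⟩ = |+_{θ₁}⟩ ⊗ |+_{θ₂}⟩. (Indeed the image {D|+_θ⟩ : θ ∈ ℝ} lies in the at most 2-dimensional span of D|+⟩ and D|−⟩, while the products of planar states span all 4 dimensions.) -/
/-- The amplitudes of a linear image of a planar state that equals a product of planar states. -/
theorem amplitude_of_map_plus_eq_tens {D : (Fin 2 → ℂ) →ₗ[ℂ] (Fin 2 × Fin 2 → ℂ)}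
    {θ θ₁ θ₂ : ℝ} (h : D (plus θ) = tens (plus θ₁) (plus θ₂)) (i j : Fin 2) :
    D (Pi.single 0 1) (i, j) + Complex.exp (θ * Complex.I) * D (Pi.single 1 1) (i, j) =
      (1 / Real.sqrt 2 : ℂ) *
        (Complex.exp (θ₁ * Complex.I) ^ (i : ℕ) * Complex.exp (θ₂ * Complex.I) ^ (j : ℕ)) := by
  have hs : (1 / Real.sqrt 2 : ℂ) ≠ 0 := by simp
  apply mul_left_cancel₀ hs
  rw [← map_plus_apply, h]
  simp only [tens, plus]
  ring

/-- No linear map `D : ℂ² → ℂ²⊗ℂ²` reaches every product of planar states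
from the planar-state family. -/
theorem no_linear_map_reaches_all_planar_products :
    ¬ ∃ D : (Fin 2 → ℂ) →ₗ[ℂ] (Fin 2 × Fin 2 → ℂ),
      ∀ θ₁ θ₂ : ℝ, ∃ θ : ℝ, D (plus θ) = tens (plus θ₁) (plus θ₂) := by
  rintro ⟨D, hD⟩
  obtain ⟨α, hα⟩ := hD 0 0
  obtain ⟨β, hβ⟩ := hD Real.pi 0
  obtain ⟨γ, hγ⟩ := hD 0 Real.pi
  have hs : (1 / Real.sqrt 2 : ℂ) ≠ 0 := by simp
  have hα₀ := amplitude_of_map_plus_eq_tens hα 0 1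
  have hα₁ := amplitude_of_map_plus_eq_tens hα 1 0
  have hβ₀ := amplitude_of_map_plus_eq_tens hβ 0 1
  have hβ₁ := amplitude_of_map_plus_eq_tens hβ 1 0
  have hγ₀ := amplitude_of_map_plus_eq_tens hγ 0 1
  generalize (1 / Real.sqrt 2 : ℂ) = s at *
  simp only [Fin.val_zero, Fin.val_one, pow_zero, pow_one, Complex.exp_pi_mul_I,
    Complex.ofReal_zero, zero_mul, Complex.exp_zero, mul_one, mul_neg]
    at hα₀ hα₁ hβ₀ hβ₁ hγ₀
  have hzero : (Complex.exp (α * Complex.I) - Complex.exp (β * Complex.I)) *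
      D (Pi.single 1 1) (0, 1) = 0 := by
    linear_combination hα₀ - hβ₀
  rcases mul_eq_zero.mp hzero with h | h
  · apply hs
    linear_combination (D (Pi.single 1 1) (1, 0) * h - hα₁ + hβ₁) / 2
  · apply hs
    linear_combination ((Complex.exp (α * Complex.I) - Complex.exp (γ * Complex.I)) * h
      - hα₀ + hγ₀) / 2
end

section
/- (Bridge operation correctness.) Let a, b ∈ ℂ² and c ∈ {0,1}, and let |φ⟩ = (1/√2)(e₀ + (−1)^c e₁). Form the three-qubit state ψ = CZ₁₂ CZ₂₃ (a ⊗ |φ⟩ ⊗ b). For a measurement outcome s ∈ {0,1}, let v_s ∈ ℂ²⊗ℂ² be the (subnormalized) post-measurement state of qubits 1 and 3 obtained by projecting the middle qubit of ψ onto the basis vector |+_{π/2}⟩ (if s = 0) or |−_{π/2}⟩ = |+_{π/2 + π}⟩ (if s = 1) and discarding it: v_s(i,k) = ∑_j conj(β_s(j))·ψ(i,j,k), where β_s is the chosen basis vector. Then for each s ∈ {0,1}, the corrected vector (Z(−π/2) Z^{s⊕c} ⊗ Z(−π/2) Z^{s⊕c}) v_s is a nonzero scalar multiple of CZ(a ⊗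 b), whenever a ≠ 0 and b ≠ 0. -/
/-- The tensor product of three one-qubit vectors. -/
def tens3 (u v w : Fin 2 → ℂ) : Fin 2 × Fin 2 × Fin 2 → ℂ :=
  fun p => u p.1 * v p.2.1 * w p.2.2

/-- Controlled-Z gate on qubits 1 and 2 of a three-qubit state. -/
def CZ12 (ψ : Fin 2 × Fin 2 × Fin 2 → ℂ) : Fin 2 × Fin 2 × Fin 2 → ℂ :=
  fun p => (-1 : ℂ) ^ ((p.1 : ℕ) * (p.2.1 : ℕ)) * ψ p

/-- Controlled-Z gate on qubits 2 and 3 of a three-qubit state. -/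
def CZ23 (ψ : Fin 2 × Fin 2 × Fin 2 → ℂ) : Fin 2 × Fin 2 × Fin 2 → ℂ :=
  fun p => (-1 : ℂ) ^ ((p.2.1 : ℕ) * (p.2.2 : ℕ)) * ψ p

/-- Controlled-Z gate on a two-qubit state. -/
def CZ2 (v : Fin 2 × Fin 2 → ℂ) : Fin 2 × Fin 2 → ℂ :=
  fun q => (-1 : ℂ) ^ ((q.1 : ℕ) * (q.2 : ℕ)) * v q

/-- The middle-qubit state `|φ⟩ = (1/√2)(e₀ + (−1)^c e₁)` of the bridge protocol. -/
noncomputable def bridgeMid (c : Fin 2) : Fin 2 → ℂ :=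
  fun j => (1 / Real.sqrt 2 : ℂ) * (-1 : ℂ) ^ ((c : ℕ) * (j : ℕ))

/-- The bridge correction `Z(−π/2) Z^{s⊕c} ⊗ Z(−π/2) Z^{s⊕c}` applied to a
two-qubit vector, where `Z(θ) = diag(1, e^{iθ})`. -/
noncomputable def bridgeCorr (s c : Fin 2) (v : Fin 2 × Fin 2 → ℂ) :
    Fin 2 × Fin 2 → ℂ :=
  fun q =>
    Complex.exp (-(Real.pi / 2) * Complex.I) ^ (q.1 : ℕ) *
      (-1 : ℂ) ^ (((s + c : Fin 2) : ℕ) * (q.1 : ℕ)) *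
    Complex.exp (-(Real.pi / 2) * Complex.I) ^ (q.2 : ℕ) *
      (-1 : ℂ) ^ (((s + c : Fin 2) : ℕ) * (q.2 : ℕ)) * v q

/-- The conjugate of the measured basis vector `|+_{π/2 + sπ}⟩`, in Cartesian form. -/
theorem star_plus_pi_div_two_add (s j : Fin 2) :
    star (plus (Real.pi / 2 + (s : ℕ) * Real.pi) j) =
      (1 / Real.sqrt 2 : ℂ) * (-(-1) ^ (s : ℕ) * Complex.I) ^ (j : ℕ) := by
  have hexp : Complex.exp (((Real.pi / 2 + (s : ℕ) * Real.pi : ℝ) : ℂ) * Complex.I) =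
      (-1) ^ (s : ℕ) * Complex.I := by
    push_cast
    rw [add_mul, Complex.exp_add, Complex.exp_pi_div_two_mul_I, mul_assoc,
      Complex.exp_nat_mul, Complex.exp_pi_mul_I, mul_comm]
  rw [plus, hexp]
  simp

/-- Bridge operation correctness: projecting the middle qubit of
`CZ₁₂ CZ₂₃ (a ⊗ |φ⟩ ⊗ b)` onto `|+_{π/2 + sπ}⟩` and applying the corrections
yields a nonzero multiple of `CZ (a ⊗ b)` (for nonzero `a`, `b`). -/
theorem bridge_operation_correctness (a b : Fin 2 → ℂ) (c : Fin 2)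
    (ha : a ≠ 0) (hb : b ≠ 0) (s : Fin 2) :
    ∃ z : ℂ, z ≠ 0 ∧
      bridgeCorr s c
        (fun q => ∑ j : Fin 2,
          star (plus (Real.pi / 2 + (s : ℕ) * Real.pi) j) *
            CZ12 (CZ23 (tens3 a (bridgeMid c) b)) (q.1, j, q.2)) =
      z • CZ2 (tens a b) := by
  refine ⟨(1 - (-1) ^ ((s : ℕ) + (c : ℕ)) * Complex.I) / 2, ?_, ?_⟩
  · intro h
    have hre := congrArg Complex.re h
    fin_cases s <;> fin_cases c <;> norm_num at hre
  · have hexp : Complex.exp (-(Real.pi / 2) * Complex.I) = -Complex.I := by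
      rw [neg_mul, Complex.exp_neg, Complex.exp_pi_div_two_mul_I, Complex.inv_I]
    have hsqrt : (1 / Real.sqrt 2 : ℂ) * (1 / Real.sqrt 2) = 1 / 2 := by
      rw [div_mul_div_comm, one_mul, ← Complex.ofReal_mul, Real.mul_self_sqrt zero_le_two,
        Complex.ofReal_ofNat]
    have hI := Complex.I_mul_I
    funext ⟨i, k⟩
    simp only [bridgeCorr, star_plus_pi_div_two_add, hexp, CZ12, CZ23, tens3, bridgeMid, CZ2,
      tens, Fin.sum_univ_two, Pi.smul_apply, smul_eq_mul]
    generalize (1 / Real.sqrt 2 : ℂ) = r at hsqrt ⊢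
    fin_cases s <;> fin_cases c <;> fin_cases i <;> fin_cases k <;> simp <;> grind
end
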